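/- In a Bayesian game with finite actions that has coarser inter-player information, every behavioral strategy profile f = (f_1,…,f_n) possesses a strong purification: there exists a pure strategy profile g = (g_1,…,g_n) such that (i) for every player i, U_i(g) = U_i(f), and for every behavioral strategy h_i of player i, U_i(h_i, g_{-i}) = U_i(h_i, f_{-i}) (strong payoff equivalence); (ii) for every player i and every x_i ∈ X_i, λ_i({t_i : g_i(t_i) = x_i}) = ∫_{T_i} f_i(t_i)({x_i}) λ_i(dt_i) (distribution equivalence); and (iii) for every player i, g_i(t_i) ∈ supp f_i(t_i) for λ_i-almost all t_i ∈ T_i (belief consistency). -/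

import Mathlib

open MeasureTheory Filter Topology Set
open scoped ENNReal

noncomputable section

/-- `D` is a `𝒢`-atom of `𝒯` under `μ`. -/
def IsCondAtom {T : Type*} (mT G : MeasurableSpace T) (μ : @MeasureTheory.Measure T mT)
    (D : Set T) : Prop :=
  MeasurableSet[mT] D ∧ 0 < μ D ∧
    ∀ D₀ : Set T, MeasurableSet[mT] D₀ → D₀ ⊆ D →
      ∃ D₁ : Set T, MeasurableSet[G] D₁ ∧ μ (symmDiff D₀ (D₁ ∩ D)) = 0

/-- `𝒯` has no `𝒢`-atom under `μ`. -/
def HasNoCondAtom {T : Type*} (mT G : MeasurableSpace T) (μ : @MeasureTheory.Measure T mT) :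
    Prop :=
  ∀ D : Set T, ¬ IsCondAtom mT G μ D

/-- A measure is atomless if every measurable set of positive measure has a measurable
subset of strictly smaller positive measure. -/
def AtomlessMeasure {T : Type*} {mT : MeasurableSpace T} (μ : Measure T) : Prop :=
  ∀ A : Set T, MeasurableSet A → 0 < μ A →
    ∃ B : Set T, MeasurableSet B ∧ B ⊆ A ∧ 0 < μ B ∧ μ B < μ A

/-- The density weighted payoff `w_i(x, t) = u_i(x, t) * q(t)`. -/
def dwPayoff {n : ℕ} {T X : Fin n → Type*}
    (u : Fin n → (∀ i, X i) → (∀ i, T i) → ℝ) (q : (∀ i, T i) → ℝ)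
    (i : Fin n) (x : ∀ k, X k) (t : ∀ k, T k) : ℝ :=
  u i x t * q t

/-- Player `i`'s inter-player information `𝒢_i`: the σ-algebra on `T i` generated by the
maps `t_i ↦ w_j(x, (t_i, t_{-i}))` for all `j ≠ i`, action profiles `x` and `t_{-i}`. -/
def interInfo {n : ℕ} {T X : Fin n → Type*}
    (u : Fin n → (∀ i, X i) → (∀ i, T i) → ℝ) (q : (∀ i, T i) → ℝ) (i : Fin n) :
    MeasurableSpace (T i) :=
  ⨆ (j : Fin n) (_ : j ≠ i) (x : ∀ k, X k) (s : ∀ k, T k),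
    MeasurableSpace.comap (fun ti : T i => dwPayoff u q j x (Function.update s i ti))
      inferInstance

/-- A pure strategy is measurable: each action has a measurable preimage. -/
def IsPureStrategy {A B : Type*} [MeasurableSpace A] (f : A → B) : Prop :=
  ∀ b : B, MeasurableSet {a | f a = b}

/-- Player `i`'s expected payoff from a pure strategy profile `f`. -/
def purePayoff {n : ℕ} {T X : Fin n → Type*} [∀ i, MeasurableSpace (T i)]
    (lam : Measure (∀ i, T i)) (u : Fin n → (∀ i, X i) → (∀ i, T i) → ℝ)
    (f : ∀ i, T i → X i) (i : Fin n) : ℝ :=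
  ∫ t, u i (fun j => f j (t j)) t ∂lam

/-- `f` is a pure strategy equilibrium. -/
def IsPureEquilibrium {n : ℕ} {T X : Fin n → Type*} [∀ i, MeasurableSpace (T i)]
    (lam : Measure (∀ i, T i)) (u : Fin n → (∀ i, X i) → (∀ i, T i) → ℝ)
    (f : ∀ i, T i → X i) : Prop :=
  (∀ i, IsPureStrategy (f i)) ∧
    ∀ (i : Fin n) (g : T i → X i), IsPureStrategy g →
      purePayoff lam u (Function.update f i g) i ≤ purePayoff lam u f i

/-- A behavioral strategy, represented as a measurable family of probability weights on
the finite action set. -/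
def IsBehavioralStrategy {A B : Type*} [MeasurableSpace A] [Fintype B] (f : A → B → ℝ) :
    Prop :=
  (∀ b, Measurable fun a => f a b) ∧ (∀ a b, 0 ≤ f a b) ∧ (∀ a, ∑ b, f a b = 1)

/-- Player `i`'s expected payoff from a behavioral strategy profile `f`. -/
def behPayoff {n : ℕ} {T X : Fin n → Type*} [∀ i, MeasurableSpace (T i)]
    [∀ i, Fintype (X i)] (lam : Measure (∀ i, T i))
    (u : Fin n → (∀ i, X i) → (∀ i, T i) → ℝ)
    (f : ∀ i, T i → X i → ℝ) (i : Fin n) : ℝ :=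
  ∫ t, ∑ x : ∀ j, X j, u i x t * ∏ j, f j (t j) (x j) ∂lam

/-- The behavioral strategy profile associated with a pure strategy profile. -/
def pureToBeh {n : ℕ} {T X : Fin n → Type*} [∀ i, DecidableEq (X i)]
    (g : ∀ i, T i → X i) : ∀ i, T i → X i → ℝ :=
  fun i ti x => if g i ti = x then 1 else 0

section ConditionalAtoms

variable {T : Type*} {G mT : MeasurableSpace T} {μ : Measure T} [IsFiniteMeasure μ]

/-- Without `G`-atoms, every set of positive measure contains a subset of positive measure that
contains no trace of a `G`-measurable set of positive measure. -/
lemma HasNoCondAtom.exists_subset (hG : G ≤ mT) (hμ : HasNoCondAtom mT G μ) {D : Set T}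
    (hD : MeasurableSet D) (hpos : 0 < μ D) :
    ∃ D₀ ⊆ D, MeasurableSet D₀ ∧ 0 < μ D₀ ∧
      ∀ C, MeasurableSet[G] C → μ ((C ∩ D) \ D₀) = 0 → μ (C ∩ D) = 0 := by
  have hnot := hμ D
  simp only [IsCondAtom, not_and, not_forall, not_exists] at hnot
  obtain ⟨D₀, hD₀, hsub, hne⟩ := hnot hD hpos
  set E : Set T := D \ D₀
  have hE : MeasurableSet E := hD.diff hD₀
  have hint : Integrable (E.indicator (1 : T → ℝ)) μ :=
    (integrable_const (1 : ℝ)).indicator hE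
  set e : T → ℝ := μ[E.indicator (1 : T → ℝ) | G]
  have he0 : 0 ≤ᵐ[μ] e :=
    condExp_nonneg (ae_of_all _ fun t => indicator_nonneg (fun _ _ => zero_le_one) t)
  have hset : ∀ C, MeasurableSet[G] C → ∫ t in C, e t ∂μ = μ.real (E ∩ C) := by
    intro C hC
    rw [setIntegral_condExp hG hint hC, integral_indicator_one hE, measureReal_restrict_apply hE]
  set Z : Set T := {t | e t = 0}
  have hZ : MeasurableSet[G] Z :=
    (stronglyMeasurable_condExp.measurable : Measurable[G] e) (measurableSet_singleton 0)
  have hEZ : μ (E ∩ Z) = 0 := by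
    have h0 : ∫ t in Z, e t ∂μ = 0 :=
      setIntegral_eq_zero_of_forall_eq_zero fun t ht => ht
    rw [hset Z hZ] at h0
    exact (measureReal_eq_zero_iff).1 h0
  refine ⟨D₀ \ Z, sdiff_subset.trans hsub, hD₀.diff (hG _ hZ), ?_, ?_⟩
  · rw [pos_iff_ne_zero]
    intro h0
    refine hne Z hZ (measure_mono_null ?_ (measure_union_null h0 hEZ))
    rintro t (⟨h1, h2⟩ | ⟨⟨h1, h2⟩, h3⟩)
    · exact Or.inl ⟨h1, fun h => h2 ⟨h, hsub h1⟩⟩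
    · exact Or.inr ⟨⟨h2, h3⟩, h1⟩
  · intro C hC h0
    have hEC : μ.real (E ∩ C) = 0 := by
      rw [measureReal_eq_zero_iff]
      refine measure_mono_null ?_ h0
      rintro t ⟨⟨h1, h2⟩, h3⟩
      exact ⟨⟨h3, h1⟩, fun h => h2 h.1⟩
    rw [← hset C hC, setIntegral_eq_zero_iff_of_nonneg_ae (ae_restrict_of_ae he0)
      integrable_condExp.integrableOn] at hEC
    have hCZ : μ (C \ Z) = 0 := by
      have := (ae_restrict_iff' (hG _ hC)).1 hEC
      refine measure_mono_null ?_ this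
      rintro t ⟨h1, h2⟩ h3
      exact h2 (h3 h1)
    refine measure_mono_null ?_ (measure_union_null hCZ h0)
    intro t ht
    by_cases h : t ∈ Z
    · exact Or.inr ⟨ht, fun h' => h'.2 h⟩
    · exact Or.inl ⟨ht.1, h⟩

/-- Without `G`-atoms, the bounded functions supported in a set of positive measure contain a
nonzero one that is conditionally orthogonal to finitely many given integrable functions. -/
lemma HasNoCondAtom.exists_condExp_mul_eq_zero (hG : G ≤ mT) (hμ : HasNoCondAtom mT G μ)
    {ι : Type*} {ψ : ι → T → ℝ} (hψ : ∀ k, Integrable (ψ k) μ) (S : Finset ι) {D : Set T}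
    (hD : MeasurableSet D) (hpos : 0 < μ D) :
    ∃ h : T → ℝ, Measurable h ∧ (∃ M, ∀ t, |h t| ≤ M) ∧ (∀ t ∉ D, h t = 0) ∧
      ¬ h =ᵐ[μ] 0 ∧ ∀ k ∈ S, μ[ψ k * h | G] =ᵐ[μ] 0 := by
  classical
  induction S using Finset.induction_on generalizing D with
  | empty =>
    refine ⟨D.indicator 1, measurable_one.indicator hD, ⟨1, fun t => ?_⟩,
      fun t ht => indicator_of_notMem ht _, fun h0 => ?_, by simp⟩
    · by_cases ht : t ∈ D <;> simp [ht]
    · refine hpos.ne' (measure_mono_null ?_ h0)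
      intro t ht h
      simp [ht] at h
  | insert k S hk ih =>
    have hprod : ∀ (j : ι) (h : T → ℝ), Measurable h → (∃ M, ∀ t, |h t| ≤ M) →
        Integrable (ψ j * h) μ := fun j h hm ⟨M, hM⟩ =>
      (hψ j).mul_bdd (c := M) hm.aestronglyMeasurable (ae_of_all _ hM)
    have pull : ∀ (j : ι) (c h : T → ℝ), StronglyMeasurable[G] c → Measurable h →
        (∃ M, ∀ t, |h t| ≤ M) → (∀ t, |c t| ≤ 1) →
        μ[ψ j * (c * h) | G] =ᵐ[μ] c * μ[ψ j * h | G] := by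
      intro j c h hc hm hb hc1
      have hi := hprod j h hm hb
      rw [show ψ j * (c * h) = c * (ψ j * h) by ring]
      exact condExp_mul_of_stronglyMeasurable_left hc
        (hi.bdd_mul (c := 1) (hc.mono hG).aestronglyMeasurable (ae_of_all _ hc1)) hi
    obtain ⟨h₁, hm₁, hb₁, hs₁, hn₁, hc₁⟩ := ih hD hpos
    set a₁ : T → ℝ := μ[ψ k * h₁ | G]
    have ha₁ : StronglyMeasurable[G] a₁ := stronglyMeasurable_condExp
    by_cases hz : a₁ =ᵐ[μ] 0
    · refine ⟨h₁, hm₁, hb₁, hs₁, hn₁, fun j hj => ?_⟩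
      obtain rfl | hj := Finset.mem_insert.1 hj
      exacts [hz, hc₁ j hj]
    set C : Set T := {t | a₁ t ≠ 0}
    have hC : MeasurableSet[G] C :=
      (ha₁.measurable : Measurable[G] a₁) (measurableSet_singleton 0).compl
    set D' : Set T := {t | h₁ t ≠ 0} ∩ C
    have hD' : MeasurableSet D' := (hm₁ (measurableSet_singleton 0).compl).inter (hG _ hC)
    have hD'pos : 0 < μ D' := by
      rw [pos_iff_ne_zero]
      intro h0
      apply hz
      have hcm : StronglyMeasurable[G] (C.indicator (1 : T → ℝ)) :=
        stronglyMeasurable_one.indicator hC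
      have hp := pull k (C.indicator 1) h₁ hcm hm₁ hb₁
        fun t => by by_cases ht : t ∈ C <;> simp [ht]
      have hz' : ψ k * (C.indicator 1 * h₁) =ᵐ[μ] 0 := by
        filter_upwards [measure_eq_zero_iff_ae_notMem.1 h0] with t ht
        by_cases htC : t ∈ C
        · have : h₁ t = 0 := by
            by_contra h
            exact ht ⟨h, htC⟩
          simp [this]
        · simp [htC]
      have hz'' : μ[ψ k * (C.indicator 1 * h₁) | G] =ᵐ[μ] 0 := by
        refine (condExp_congr_ae hz').trans ?_
        rw [condExp_zero]
      filter_upwards [hp, hz''] with t h1 h2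
      by_contra h
      have htC : t ∈ C := h
      rw [h2] at h1
      simp [htC] at h1
      exact h h1.symm
    obtain ⟨D₀, hD₀sub, hD₀, hD₀pos, hD₀max⟩ := hμ.exists_subset hG hD' hD'pos
    obtain ⟨h₂, hm₂, hb₂, hs₂, hn₂, hc₂⟩ := ih hD₀ hD₀pos
    set a₂ : T → ℝ := μ[ψ k * h₂ | G]
    have ha₂ : StronglyMeasurable[G] a₂ := stronglyMeasurable_condExp
    set r : T → ℝ := fun t => 1 + |a₁ t| + |a₂ t|
    have hr : ∀ t, 0 < r t := fun t => by positivity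
    have hrm : StronglyMeasurable[G] r := by
      have h1 : Measurable[G] a₁ := ha₁.measurable
      have h2 : Measurable[G] a₂ := ha₂.measurable
      exact Measurable.stronglyMeasurable
        ((measurable_const.add (measurable_norm.comp h1)).add (measurable_norm.comp h2))
    set c₁ : T → ℝ := fun t => a₂ t / r t
    set c₂ : T → ℝ := fun t => -a₁ t / r t
    have hcm₁ : StronglyMeasurable[G] c₁ :=
      (ha₂.measurable.div hrm.measurable).stronglyMeasurable
    have hcm₂ : StronglyMeasurable[G] c₂ :=
      (ha₁.measurable.neg.div hrm.measurable).stronglyMeasurable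
    have hcb₁ : ∀ t, |c₁ t| ≤ 1 := fun t => by
      rw [abs_div, abs_of_pos (hr t), div_le_one (hr t)]
      have := abs_nonneg (a₁ t)
      simp only [r]; linarith
    have hcb₂ : ∀ t, |c₂ t| ≤ 1 := fun t => by
      rw [abs_div, abs_of_pos (hr t), div_le_one (hr t), abs_neg]
      have := abs_nonneg (a₂ t)
      simp only [r]; linarith
    have hD₀D : D₀ ⊆ D := fun t ht => by
      by_contra h
      exact (hD₀sub ht).1 (hs₁ t h)
    have hcm₁' : Measurable c₁ := (hcm₁.mono hG).measurable
    have hcm₂' : Measurable c₂ := (hcm₂.mono hG).measurable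
    have hbm : ∀ c h : T → ℝ, (∀ t, |c t| ≤ 1) → (∃ M, ∀ t, |h t| ≤ M) →
        ∃ M, ∀ t, |(c * h) t| ≤ M := by
      rintro c h hc ⟨M, hM⟩
      refine ⟨M, fun t => ?_⟩
      rw [Pi.mul_apply, abs_mul]
      exact (mul_le_of_le_one_left (abs_nonneg _) (hc t)).trans (hM t)
    have hsum : ∀ j, μ[ψ j * (c₁ * h₁ + c₂ * h₂) | G] =ᵐ[μ]
        c₁ * μ[ψ j * h₁ | G] + c₂ * μ[ψ j * h₂ | G] := by
      intro j
      rw [mul_add]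
      refine (condExp_add (hprod j _ (hcm₁'.mul hm₁) (hbm _ _ hcb₁ hb₁))
        (hprod j _ (hcm₂'.mul hm₂) (hbm _ _ hcb₂ hb₂)) G).trans ?_
      exact (pull j c₁ h₁ hcm₁ hm₁ hb₁ hcb₁).add (pull j c₂ h₂ hcm₂ hm₂ hb₂ hcb₂)
    refine ⟨c₁ * h₁ + c₂ * h₂, (hcm₁'.mul hm₁).add (hcm₂'.mul hm₂), ?_, ?_, ?_, ?_⟩
    · obtain ⟨M₁, hM₁⟩ := hbm _ _ hcb₁ hb₁
      obtain ⟨M₂, hM₂⟩ := hbm _ _ hcb₂ hb₂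
      exact ⟨M₁ + M₂, fun t => (abs_add_le _ _).trans (add_le_add (hM₁ t) (hM₂ t))⟩
    · intro t ht
      simp [hs₁ t ht, hs₂ t fun h => ht (hD₀D h)]
    · intro h0
      have key : ∀ᵐ t ∂μ, a₂ t * h₁ t = a₁ t * h₂ t := by
        filter_upwards [h0] with t ht
        have : a₂ t / r t * h₁ t + -a₁ t / r t * h₂ t = 0 := ht
        have hne := (hr t).ne'
        field_simp at this
        linarith
      have hnull : μ ({t | a₂ t ≠ 0} ∩ D') = 0 := by
        refine hD₀max _ ((ha₂.measurable : Measurable[G] a₂)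
          (measurableSet_singleton 0).compl) (measure_mono_null ?_ key)
        rintro t ⟨⟨h1, h2⟩, h3⟩ h4
        have h4 : a₂ t * h₁ t = a₁ t * h₂ t := h4
        rw [hs₂ t h3, mul_zero] at h4
        exact mul_ne_zero h1 h2.1 h4
      apply hn₂
      filter_upwards [key, measure_eq_zero_iff_ae_notMem.1 hnull] with t h1 h2
      by_contra h3
      have h4 : t ∈ D₀ := by
        by_contra h
        exact h3 (hs₂ t h)
      have h5 := hD₀sub h4
      have h6 : a₂ t = 0 := by
        by_contra h
        exact h2 ⟨h, h5⟩
      rw [h6, zero_mul] at h1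
      exact mul_ne_zero h5.2 h3 h1.symm
    · intro j hj
      obtain rfl | hj := Finset.mem_insert.1 hj
      · refine (hsum j).trans (ae_of_all _ fun t => ?_)
        change a₂ t / r t * a₁ t + -a₁ t / r t * a₂ t = 0
        ring
      · filter_upwards [hsum j, hc₁ j hj, hc₂ j hj] with t h1 h2 h3
        simp [h1, h2, h3]

end ConditionalAtoms

/-- A nonempty bounded closed convex set in a real Hilbert space has an extreme point. -/
lemma extremePoints_nonempty_of_isClosed_of_isBounded {E : Type*} [NormedAddCommGroup E]
    [InnerProductSpace ℝ E] [CompleteSpace E] {K : Set E} (hcl : IsClosed K)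
    (hconv : Convex ℝ K) (hbd : Bornology.IsBounded K) (hne : K.Nonempty) :
    (K.extremePoints ℝ).Nonempty := by
  have : LocallyConvexSpace ℝ (WeakDual ℝ E) :=
    inferInstanceAs (LocallyConvexSpace ℝ (WeakBilin (topDualPairing ℝ E)))
  set D : E ≃ₗ[ℝ] WeakDual ℝ E :=
    (InnerProductSpace.toDual ℝ E).toLinearEquiv.trans StrongDual.toWeakDual
  have hD : ∀ x y, D x y = inner ℝ x y := fun x y => rfl
  obtain ⟨R, hR⟩ := hbd.subset_closedBall 0
  have hnorm : ∀ x ∈ K, ‖x‖ ≤ R := fun x hx => by simpa using hR hx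
  have hbdd : ∀ y, BddAbove ((fun x => inner ℝ x y) '' K) := by
    rintro y
    refine ⟨R * ‖y‖, ?_⟩
    rintro _ ⟨x, hx, rfl⟩
    exact (real_inner_le_norm x y).trans
      (mul_le_mul_of_nonneg_right (hnorm x hx) (norm_nonneg y))
  have himage : D '' K = ⋂ y, {l : WeakDual ℝ E | l y ≤ sSup ((fun x => inner ℝ x y) '' K)} := by
    ext l
    simp only [mem_image, mem_iInter, mem_ofPred_eq]
    constructor
    · rintro ⟨x, hx, rfl⟩ y
      exact le_csSup (hbdd y) ⟨x, hx, rfl⟩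
    · intro h
      refine ⟨D.symm l, ?_, D.apply_symm_apply l⟩
      by_contra hx
      obtain ⟨φ, c, h1, h2⟩ := geometric_hahn_banach_closed_point hconv hcl hx
      have hφ : ∀ z, inner ℝ z ((InnerProductSpace.toDual ℝ E).symm φ) = φ z := fun z => by
        rw [real_inner_comm, InnerProductSpace.toDual_symm_apply]
      have h3 := h ((InnerProductSpace.toDual ℝ E).symm φ)
      have h4 : sSup ((fun x => inner ℝ x ((InnerProductSpace.toDual ℝ E).symm φ)) '' K) ≤ c := by
        refine csSup_le (hne.image _) ?_
        rintro _ ⟨x, hx, rfl⟩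
        simpa only [hφ] using (h1 x hx).le
      have h5 : l ((InnerProductSpace.toDual ℝ E).symm φ) = φ (D.symm l) := by
        rw [← hφ, ← hD, D.apply_symm_apply]
      linarith
  have hcomp : IsCompact (D '' K) := by
    refine WeakDual.isCompact_of_bounded_of_closed ?_ ?_
    · refine (WeakDual.isBounded_closedBall 0 R).subset ?_
      rintro _ ⟨x, hx, rfl⟩
      have : ‖WeakDual.toStrongDual (D x)‖ ≤ R :=
        ((InnerProductSpace.toDual ℝ E).norm_map x).trans_le (hnorm x hx)
      simpa using this
    · rw [himage]
      exact isClosed_iInter fun y => isClosed_Iic.preimage (WeakDual.eval_continuous y)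
  have := hcomp.extremePoints_nonempty (hne.image _)
  rw [← image_extremePoints D K] at this
  exact this.of_image

section ConditionalLyapunov

variable {T : Type*} {G mT : MeasurableSpace T} {μ : Measure T} [IsFiniteMeasure μ]

/-- A conditional Lyapunov theorem: without `G`-atoms, a measurable function with values in
`[0, 1]` can be replaced by an indicator without changing its integrals against finitely many
integrable densities over the sets of `G`. -/
lemma HasNoCondAtom.exists_setIntegral_eq (hG : G ≤ mT) (hμ : HasNoCondAtom mT G μ)
    {ι : Type*} [Finite ι] {ψ : ι → T → ℝ} (hψm : ∀ k, Measurable (ψ k))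
    (hψ : ∀ k, Integrable (ψ k) μ) {f : T → ℝ} (hf : Measurable f) (hf0 : ∀ t, 0 ≤ f t)
    (hf1 : ∀ t, f t ≤ 1) :
    ∃ A, MeasurableSet A ∧ ∀ k B, MeasurableSet[G] B →
      ∫ t in B, ψ k t * A.indicator 1 t ∂μ = ∫ t in B, ψ k t * f t ∂μ := by
  classical
  have := Fintype.ofFinite ι
  set w : T → ℝ := fun t => 1 + ∑ k, |ψ k t|
  set s : T → ℝ := fun t => √(w t)
  have hw1 : ∀ t, 1 ≤ w t := fun t =>
    le_add_of_nonneg_right (Finset.sum_nonneg fun k _ => abs_nonneg _)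
  have hwψ : ∀ k t, |ψ k t| ≤ w t := fun k t => by
    have := Finset.single_le_sum (f := fun k => |ψ k t|) (fun k _ => abs_nonneg _)
      (Finset.mem_univ k)
    simp only [w]; linarith
  have hwm : Measurable w :=
    measurable_const.add (Finset.measurable_sum _ fun k _ => (hψm k).abs)
  have hwi : Integrable w μ :=
    (integrable_const 1).add (integrable_finsetSum _ fun k _ => (hψ k).abs)
  have hs0 : ∀ t, 0 < s t := fun t => Real.sqrt_pos.2 (one_pos.trans_le (hw1 t))
  have hss : ∀ t, s t ^ 2 = w t := fun t => Real.sq_sqrt (zero_le_one.trans (hw1 t))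
  have hsm : Measurable s := hwm.sqrt
  have hs2 : MemLp s 2 μ := by
    rw [memLp_two_iff_integrable_sq hsm.aestronglyMeasurable]
    simpa only [hss] using hwi
  have hmul : ∀ g : T → ℝ, Measurable g → (∃ M, ∀ t, |g t| ≤ M) →
      MemLp (fun t => s t * g t) 2 μ := by
    rintro g hg ⟨M, hM⟩
    refine MemLp.of_le_mul (c := M) hs2 (hsm.mul hg).aestronglyMeasurable (ae_of_all _ fun t => ?_)
    rw [norm_mul, mul_comm]
    exact mul_le_mul_of_nonneg_right (hM t) (norm_nonneg _)
  have hφ : ∀ k, MemLp (fun t => ψ k t / s t) 2 μ := by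
    intro k
    rw [memLp_two_iff_integrable_sq (f := fun t => ψ k t / s t)
      ((hψm k).div hsm).aestronglyMeasurable]
    refine (hψ k).mono (((hψm k).div hsm).pow_const 2).aestronglyMeasurable (ae_of_all _ fun t => ?_)
    rw [div_pow, hss, norm_div, norm_pow, Real.norm_eq_abs, Real.norm_eq_abs,
      abs_of_pos (one_pos.trans_le (hw1 t)), div_le_iff₀ (one_pos.trans_le (hw1 t)), sq]
    exact mul_le_mul_of_nonneg_left (hwψ k t) (abs_nonneg _)
  let e : ι → {B : Set T // MeasurableSet[G] B} → Lp ℝ 2 μ := fun k B =>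
    ((hφ k).indicator (hG _ B.2)).toLp _
  have he : ∀ k B (F : Lp ℝ 2 μ) (g : T → ℝ), F =ᵐ[μ] (fun t => s t * g t) →
      inner ℝ F (e k B) = ∫ t in B.1, ψ k t * g t ∂μ := by
    intro k B F g hFg
    rw [L2.inner_def, ← integral_indicator (hG _ B.2)]
    refine integral_congr_ae ?_
    filter_upwards [hFg, ((hφ k).indicator (hG _ B.2)).coeFn_toLp] with t h1 h2
    rw [h1, h2]
    by_cases ht : t ∈ B.1
    · simp only [ht, indicator_of_mem, RCLike.inner_apply, conj_trivial]
      have := (hs0 t).ne'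
      field_simp
    · simp [ht]
  let sL : Lp ℝ 2 μ := hs2.toLp s
  have hsL : sL =ᵐ[μ] s := hs2.coeFn_toLp
  let K : Set (Lp ℝ 2 μ) := Icc 0 sL ∩
    ⋂ k, ⋂ B, {F | inner ℝ F (e k B) = ∫ t in B.1, ψ k t * f t ∂μ}
  have hmemK : ∀ (F : Lp ℝ 2 μ) (g : T → ℝ), F =ᵐ[μ] (fun t => s t * g t) →
      (F ∈ K ↔ (∀ᵐ t ∂μ, 0 ≤ g t ∧ g t ≤ 1) ∧
        ∀ k B, MeasurableSet[G] B → ∫ t in B, ψ k t * g t ∂μ = ∫ t in B, ψ k t * f t ∂μ) := by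
    intro F g hFg
    simp only [K, mem_inter_iff, mem_Icc, mem_iInter, mem_ofPred_eq, Subtype.forall,
      he _ _ F g hFg]
    refine and_congr_left' ?_
    rw [← Lp.coeFn_nonneg, ← Lp.coeFn_le, eventually_and]
    refine and_congr (eventually_congr ?_) (eventually_congr ?_)
    · filter_upwards [hFg] with t ht
      rw [ht, Pi.zero_apply, mul_nonneg_iff_of_pos_left (hs0 t)]
    · filter_upwards [hFg, hsL] with t ht h2
      rw [ht, h2, mul_le_iff_le_one_right (hs0 t)]
  have hcl : IsClosed K := isClosed_Icc.inter <| isClosed_iInter fun k => isClosed_iInter fun B =>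
    isClosed_eq (continuous_id.inner continuous_const) continuous_const
  have hconv : Convex ℝ K := by
    have : PosSMulMono ℝ (Lp ℝ 2 μ) := ⟨fun a ha x y hxy => by
      rw [← Lp.coeFn_le] at hxy ⊢
      filter_upwards [hxy, Lp.coeFn_smul a x, Lp.coeFn_smul a y] with t h1 h2 h3
      rw [h2, h3]
      exact mul_le_mul_of_nonneg_left h1 ha⟩
    refine (convex_Icc _ _).inter (convex_iInter fun k => convex_iInter fun B => ?_)
    intro x hx y hy a b _ _ hab
    simp only [mem_ofPred_eq] at hx hy ⊢
    rw [inner_add_left, real_inner_smul_left, real_inner_smul_left, hx, hy, ← add_mul, hab, one_mul]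
  have hbd : Bornology.IsBounded K := by
    refine (Metric.isBounded_closedBall (x := 0) (r := ‖sL‖)).subset fun F hF => ?_
    rw [mem_closedBall_zero_iff]
    refine Lp.norm_le_norm_of_ae_le ?_
    filter_upwards [(Lp.coeFn_nonneg F).2 hF.1.1, (Lp.coeFn_le _ _).2 hF.1.2] with t h1 h2
    rw [Real.norm_of_nonneg h1]
    exact h2.trans (le_abs_self _)
  have hne : K.Nonempty := by
    have hm := hmul f hf ⟨1, fun t => (abs_of_nonneg (hf0 t)).trans_le (hf1 t)⟩
    refine ⟨hm.toLp _, (hmemK _ f hm.coeFn_toLp).2 ⟨ae_of_all _ fun t => ⟨hf0 t, hf1 t⟩,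
      fun k B _ => rfl⟩⟩
  obtain ⟨F, hF⟩ := extremePoints_nonempty_of_isClosed_of_isBounded hcl hconv hbd hne
  rw [mem_extremePoints] at hF
  obtain ⟨hFK, hFext⟩ := hF
  set g : T → ℝ := fun t => F t / s t
  have hgm : Measurable g := (Lp.stronglyMeasurable F).measurable.div hsm
  have hFg : F =ᵐ[μ] fun t => s t * g t := ae_of_all _ fun t => by
    simp only [g]
    rw [mul_div_cancel₀ _ (hs0 t).ne']
  obtain ⟨hg01, hgint⟩ := (hmemK F g hFg).1 hFK
  have hψg : ∀ k, Integrable (fun t => ψ k t * g t) μ := fun k =>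
    (hψ k).mul_bdd (c := 1) hgm.aestronglyMeasurable <| by
      filter_upwards [hg01] with t ht
      rw [Real.norm_of_nonneg ht.1]
      exact ht.2
  have hnull : ∀ ε : ℝ, 0 < ε → μ {t | ε ≤ g t ∧ g t ≤ 1 - ε} = 0 := by
    intro ε hε
    by_contra hpos
    set D : Set T := {t | ε ≤ g t ∧ g t ≤ 1 - ε}
    have hD : MeasurableSet D :=
      (measurableSet_le measurable_const hgm).inter (measurableSet_le hgm measurable_const)
    obtain ⟨h, hhm, ⟨M, hM⟩, hhD, hh0, hhψ⟩ :=
      hμ.exists_condExp_mul_eq_zero hG hψ Finset.univ hD (pos_iff_ne_zero.2 hpos)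
    have hM0 : 0 < |M| + 1 := by positivity
    have key : ∀ c : ℝ, |c| ≤ ε / (|M| + 1) → ∀ F' : Lp ℝ 2 μ,
        F' =ᵐ[μ] (fun t => s t * (g t + c * h t)) → F' ∈ K := by
      intro c hc F' hF'
      refine (hmemK F' _ hF').2 ⟨?_, ?_⟩
      · filter_upwards [hg01] with t ht
        by_cases htD : t ∈ D
        · have hb : |c * h t| ≤ ε := by
            rw [abs_mul]
            calc |c| * |h t| ≤ ε / (|M| + 1) * (|M| + 1) :=
                  mul_le_mul hc (((hM t).trans (le_abs_self M)).trans (by linarith))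
                    (abs_nonneg _) (by positivity)
              _ = ε := by field_simp
          have := abs_le.1 hb
          exact ⟨by linarith [htD.1], by linarith [htD.2]⟩
        · simpa [hhD t htD] using ht
      · intro k B hB
        have hhi : Integrable (ψ k * h) μ :=
          (hψ k).mul_bdd (c := M) hhm.aestronglyMeasurable (ae_of_all _ hM)
        have h0 : ∫ t in B, (ψ k * h) t ∂μ = 0 := by
          rw [← setIntegral_condExp hG hhi hB]
          refine integral_eq_zero_of_ae (ae_restrict_of_ae (hhψ k (Finset.mem_univ k)))
        have h1 : ∀ t, ψ k t * (g t + c * h t) = ψ k t * g t + c * (ψ k * h) t := fun t => by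
          simp only [Pi.mul_apply]; ring
        simp only [h1]
        rw [integral_add (hψg k).integrableOn (hhi.const_mul c).integrableOn,
          integral_const_mul, h0, mul_zero, add_zero, hgint k B hB]
    have hshm := hmul h hhm ⟨M, hM⟩
    set H : Lp ℝ 2 μ := hshm.toLp _
    have hH : H =ᵐ[μ] fun t => s t * h t := hshm.coeFn_toLp
    set c : ℝ := ε / (|M| + 1)
    have hc : 0 < c := div_pos hε hM0
    have hplus : F + c • H ∈ K := by
      refine key c (abs_of_pos hc).le _ ?_
      filter_upwards [Lp.coeFn_add F (c • H), Lp.coeFn_smul c H, hH, hFg] with t h1 h2 h3 h4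
      rw [h1, Pi.add_apply, h2, Pi.smul_apply, h3, h4, smul_eq_mul]
      ring
    have hminus : F - c • H ∈ K := by
      refine key (-c) (by rw [abs_neg, abs_of_pos hc]) _ ?_
      filter_upwards [Lp.coeFn_sub F (c • H), Lp.coeFn_smul c H, hH, hFg] with t h1 h2 h3 h4
      rw [h1, Pi.sub_apply, h2, Pi.smul_apply, h3, h4, smul_eq_mul]
      ring
    have hmid : F ∈ openSegment ℝ (F + c • H) (F - c • H) := by
      refine ⟨1 / 2, 1 / 2, by norm_num, by norm_num, by norm_num, ?_⟩
      rw [← smul_add, add_add_sub_cancel, ← two_smul ℝ F, smul_smul]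
      norm_num
    have hzero := (hFext _ hplus _ hminus hmid).1
    have hH0 : H = 0 := by
      have : c • H = 0 := by simpa using hzero
      exact (smul_eq_zero.1 this).resolve_left hc.ne'
    apply hh0
    have : H =ᵐ[μ] 0 := by
      rw [hH0]
      exact Lp.coeFn_zero _ _ _
    filter_upwards [hH, this] with t h1 h2
    rw [h2, Pi.zero_apply] at h1
    exact (mul_eq_zero.1 h1.symm).resolve_left (hs0 t).ne'
  set A : Set T := {t | g t = 1}
  have hA : MeasurableSet A := hgm (measurableSet_singleton 1)
  have hgA : g =ᵐ[μ] A.indicator 1 := by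
    have hall : ∀ᵐ t ∂μ, ∀ N : ℕ, ¬ (1 / ((N : ℝ) + 1) ≤ g t ∧ g t ≤ 1 - 1 / ((N : ℝ) + 1)) :=
      ae_all_iff.2 fun N => measure_eq_zero_iff_ae_notMem.1 (hnull _ (by positivity))
    filter_upwards [hall, hg01] with t h1 h2
    by_cases h3 : g t = 1
    · rw [h3, indicator_of_mem (show t ∈ A from h3), Pi.one_apply]
    · rw [indicator_of_notMem (show t ∉ A from h3)]
      by_contra h4
      have h5 : 0 < g t := lt_of_le_of_ne h2.1 (Ne.symm h4)
      have h6 : g t < 1 := lt_of_le_of_ne h2.2 h3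
      obtain ⟨N, hN⟩ := exists_nat_one_div_lt (lt_min h5 (sub_pos.2 h6))
      rw [lt_min_iff] at hN
      exact h1 N ⟨hN.1.le, by linarith [hN.2]⟩
  refine ⟨A, hA, fun k B hB => ?_⟩
  rw [← hgint k B hB]
  refine integral_congr_ae (ae_restrict_of_ae ?_)
  filter_upwards [hgA] with t ht
  rw [ht]

/-- The conditional Lyapunov theorem for finitely supported measurable families of weights. -/
lemma HasNoCondAtom.exists_forall_setIntegral_eq (hG : G ≤ mT) (hμ : HasNoCondAtom mT G μ)
    {ι : Type*} [Finite ι] {ψ : ι → T → ℝ} (hψm : ∀ k, Measurable (ψ k))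
    (hψ : ∀ k, Integrable (ψ k) μ) {X : Type*} {S : Finset X} (hS : S.Nonempty)
    {f : T → X → ℝ} (hf : ∀ x, Measurable fun t => f t x) (hf0 : ∀ t x, 0 ≤ f t x)
    (hf1 : ∀ t, ∑ x ∈ S, f t x = 1) :
    ∃ g : T → X, (∀ t, g t ∈ S) ∧ (∀ x, MeasurableSet {t | g t = x}) ∧
      ∀ x ∈ S, ∀ k B, MeasurableSet[G] B →
        ∫ t in B, ψ k t * {t | g t = x}.indicator 1 t ∂μ = ∫ t in B, ψ k t * f t x ∂μ := by
  classical
  induction hS using Finset.Nonempty.cons_induction generalizing ψ f with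
  | singleton a =>
    refine ⟨fun _ => a, fun _ => Finset.mem_singleton_self a, fun x => .const _, ?_⟩
    intro x hx k B _
    obtain rfl := Finset.mem_singleton.1 hx
    have : ∀ t, f t x = 1 := fun t => by simpa using hf1 t
    simp [this]
  | cons a S ha hS ih =>
    simp only [Finset.sum_cons] at hf1
    have hfa1 : ∀ t, f t a ≤ 1 := fun t => by
      linarith [hf1 t, Finset.sum_nonneg fun x (_ : x ∈ S) => hf0 t x]
    have hcard : (0 : ℝ) < S.card := by exact_mod_cast hS.card_pos
    let r : T → X → ℝ := fun t x => if f t a = 1 then (S.card : ℝ)⁻¹ else f t x / (1 - f t a)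
    have hrm : ∀ x, Measurable fun t => r t x := fun x =>
      Measurable.ite (hf a (measurableSet_singleton 1)) measurable_const
        ((hf x).div (measurable_const.sub (hf a)))
    have hr0 : ∀ t x, 0 ≤ r t x := fun t x => by
      simp only [r]
      split_ifs
      · positivity
      · exact div_nonneg (hf0 t x) (sub_nonneg.2 (hfa1 t))
    have hr1 : ∀ t, ∑ x ∈ S, r t x = 1 := fun t => by
      simp only [r]
      split_ifs with h
      · rw [Finset.sum_const, nsmul_eq_mul, mul_inv_cancel₀ hcard.ne']
      · rw [← Finset.sum_div, div_eq_one_iff_eq (sub_ne_zero.2 (Ne.symm h))]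
        linarith [hf1 t]
    have hrle : ∀ t, ∀ x ∈ S, r t x ≤ 1 := fun t x hx =>
      (Finset.single_le_sum (fun y _ => hr0 t y) hx).trans_eq (hr1 t)
    have hrf : ∀ t, ∀ x ∈ S, r t x * (1 - f t a) = f t x := fun t x hx => by
      simp only [r]
      split_ifs with h
      · have h0 : ∑ x ∈ S, f t x = 0 := by linarith [hf1 t]
        rw [(Finset.sum_eq_zero_iff_of_nonneg fun y _ => hf0 t y).1 h0 x hx, h, sub_self, mul_zero]
      · exact div_mul_cancel₀ _ (sub_ne_zero.2 (Ne.symm h))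
    have hψr : ∀ k, ∀ x ∈ S, Integrable (fun t => ψ k t * r t x) μ := fun k x hx =>
      (hψ k).mul_bdd (c := 1) (hrm x).aestronglyMeasurable <| ae_of_all _ fun t => by
        rw [Real.norm_of_nonneg (hr0 t x)]
        exact hrle t x hx
    obtain ⟨A, hA, hAint⟩ := hμ.exists_setIntegral_eq hG
      (ψ := fun p : ι × Option S => fun t => ψ p.1 t * p.2.elim 1 fun x => r t x)
      (by
        rintro ⟨k, _ | x⟩
        exacts [(hψm k).mul measurable_const, (hψm k).mul (hrm x)])
      (by
        rintro ⟨k, _ | x⟩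
        exacts [(hψ k).mul_const 1, hψr k x x.2])
      (hf a) (fun t => hf0 t a) hfa1
    obtain ⟨g, hgS, hgm, hgint⟩ := ih (ψ := fun k => Aᶜ.indicator (ψ k))
      (fun k => (hψm k).indicator hA.compl) (fun k => (hψ k).indicator hA.compl) hrm hr0 hr1
    refine ⟨fun t => if t ∈ A then a else g t, fun t => ?_, fun x => ?_, ?_⟩
    · dsimp only
      split_ifs
      exacts [Finset.mem_cons_self a S, Finset.mem_cons_of_mem (hgS t)]
    · have : {t | (if t ∈ A then a else g t) = x} = A.ite {_t | a = x} {t | g t = x} := by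
        ext t
        by_cases h : t ∈ A <;> simp [Set.ite, h]
      rw [this]
      exact hA.ite (.const _) (hgm x)
    · intro x hx k B hB
      obtain rfl | hx := Finset.mem_cons.1 hx
      · have hset : {t | (if t ∈ A then x else g t) = x} = A := by
          ext t
          by_cases h : t ∈ A
          · simp [h]
          · have : g t ≠ x := fun h' => ha (h' ▸ hgS t)
            simp [h, this]
        rw [hset]
        simpa using hAint (k, none) B hB
      · have hax : a ≠ x := fun h => ha (h ▸ hx)
        have h1 := hgint x hx k B hB
        have h2 := hAint (k, some ⟨x, hx⟩) B hB
        simp only [Option.elim_some] at h2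
        have hl : ∀ t, ψ k t * {t | (if t ∈ A then a else g t) = x}.indicator 1 t =
            Aᶜ.indicator (ψ k) t * {t | g t = x}.indicator 1 t := fun t => by
          by_cases h : t ∈ A <;> simp [h, hax, indicator_apply]
        have hm : ∀ t, Aᶜ.indicator (ψ k) t * r t x =
            ψ k t * r t x - ψ k t * r t x * A.indicator 1 t := fun t => by
          by_cases h : t ∈ A <;> simp [h]
        have hr : ∀ t, ψ k t * f t x = ψ k t * r t x - ψ k t * r t x * f t a := fun t => by
          by_cases h : x ∈ S
          · rw [← hrf t x h]; ring
          · exact absurd hx h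
        have hi := hψr k x hx
        simp only [hl, hr]
        rw [h1]
        simp only [hm]
        rw [integral_sub hi.integrableOn, integral_sub hi.integrableOn, h2]
        · refine (hi.mul_bdd (c := 1) (hf a).aestronglyMeasurable
            (ae_of_all _ fun t => ?_)).integrableOn
          rw [Real.norm_of_nonneg (hf0 t a)]
          exact hfa1 t
        · refine (hi.mul_bdd (c := 1) (measurable_one.indicator hA).aestronglyMeasurable
            (ae_of_all _ fun t => ?_)).integrableOn
          by_cases h : t ∈ A <;> simp [h]

/-- Without `G`-atoms, a behavioral strategy has a purification with the same integrals against
`G`-measurable functions and against finitely many further functions. -/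
lemma HasNoCondAtom.exists_isPureStrategy (hG : G ≤ mT) (hμ : HasNoCondAtom mT G μ)
    {κ : Type*} [Finite κ] {φ : κ → T → ℝ} (hφm : ∀ k, Measurable (φ k))
    (hφ : ∀ k, Integrable (φ k) μ) {X : Type*} [Fintype X] [DecidableEq X] [Nonempty X]
    {f : T → X → ℝ} (hf : IsBehavioralStrategy f) :
    ∃ g : T → X, IsPureStrategy g ∧
      (∀ x (w : T → ℝ), Measurable[G] w → Integrable w μ →
        ∫ t, w t * (if g t = x then 1 else 0) ∂μ = ∫ t, w t * f t x ∂μ) ∧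
      (∀ x k, ∫ t, φ k t * (if g t = x then 1 else 0) ∂μ = ∫ t, φ k t * f t x ∂μ) ∧
      ∀ᵐ t ∂μ, 0 < f t (g t) := by
  obtain ⟨hfm, hf0, hf1⟩ := hf
  let ψ : Option (κ ⊕ X) → T → ℝ := fun o =>
    o.elim 1 (Sum.elim φ fun x => {t | f t x = 0}.indicator 1)
  have hZ : ∀ x, MeasurableSet {t | f t x = 0} := fun x => hfm x (measurableSet_singleton 0)
  obtain ⟨g, -, hgm, hg⟩ := hμ.exists_forall_setIntegral_eq hG (ψ := ψ)
    (by
      rintro (_ | k | x)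
      exacts [measurable_one, hφm k, measurable_one.indicator (hZ x)])
    (by
      rintro (_ | k | x)
      exacts [integrable_const 1, hφ k, (integrable_const 1).indicator (hZ x)])
    Finset.univ_nonempty hfm hf0 hf1
  have hind : ∀ x t, (if g t = x then (1 : ℝ) else 0) = {t | g t = x}.indicator 1 t :=
    fun x t => by simp [indicator_apply]
  have hfle : ∀ t x, f t x ≤ 1 := fun t x =>
    (Finset.single_le_sum (fun y _ => hf0 t y) (Finset.mem_univ x)).trans_eq (hf1 t)
  have hfb : ∀ x, ∀ᵐ t ∂μ, ‖f t x‖ ≤ 1 := fun x => ae_of_all _ fun t => by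
    rw [Real.norm_of_nonneg (hf0 t x)]
    exact hfle t x
  have hib : ∀ x, ∀ᵐ t ∂μ, ‖{t | g t = x}.indicator (1 : T → ℝ) t‖ ≤ 1 := fun x =>
    ae_of_all _ fun t => by by_cases h : g t = x <;> simp [h]
  have hfi : ∀ x, Integrable (fun t => f t x) μ := fun x =>
    Integrable.of_bound (hfm x).aestronglyMeasurable 1 (hfb x)
  have hii : ∀ x, Integrable ({t | g t = x}.indicator (1 : T → ℝ)) μ := fun x =>
    (integrable_const 1).indicator (hgm x)
  refine ⟨g, hgm, fun x w hw hwi => ?_, fun x k => ?_, ?_⟩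
  · simp only [hind]
    have hcond : μ[{t | g t = x}.indicator (1 : T → ℝ) | G] =ᵐ[μ] μ[fun t => f t x | G] := by
      refine ae_eq_condExp_of_forall_setIntegral_eq hG (hfi x)
        (fun _ _ _ => integrable_condExp.integrableOn) (fun B hB _ => ?_)
        stronglyMeasurable_condExp.aestronglyMeasurable
      rw [setIntegral_condExp hG (hii x) hB]
      simpa [ψ] using hg x (Finset.mem_univ x) none B hB
    have h1 := condExp_mul_of_stronglyMeasurable_left (μ := μ) hw.stronglyMeasurable
      (hwi.mul_bdd (hii x).aestronglyMeasurable (hib x)) (hii x)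
    have h2 := condExp_mul_of_stronglyMeasurable_left (μ := μ) hw.stronglyMeasurable
      (hwi.mul_bdd (hfi x).aestronglyMeasurable (hfb x)) (hfi x)
    calc ∫ t, w t * {t | g t = x}.indicator 1 t ∂μ
        = ∫ t, (μ[w * {t | g t = x}.indicator (1 : T → ℝ) | G]) t ∂μ := (integral_condExp hG).symm
      _ = ∫ t, (μ[w * (fun t => f t x) | G]) t ∂μ := by
          refine integral_congr_ae ?_
          filter_upwards [h1, h2, hcond] with t h1 h2 h3
          rw [h1, h2, Pi.mul_apply, Pi.mul_apply, h3]
      _ = ∫ t, w t * f t x ∂μ := integral_condExp hG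
  · simp only [hind]
    simpa [ψ] using hg x (Finset.mem_univ x) (some (Sum.inl k)) univ MeasurableSet.univ
  · have hx : ∀ x, ∀ᵐ t ∂μ, ¬ (g t = x ∧ f t x = 0) := fun x => by
      have h := hg x (Finset.mem_univ x) (some (Sum.inr x)) univ MeasurableSet.univ
      have hz : ∀ t, {t | f t x = 0}.indicator (1 : T → ℝ) t * f t x = 0 := fun t => by
        by_cases h : f t x = 0 <;> simp [h]
      have hp : ∀ t, {t | f t x = 0}.indicator (1 : T → ℝ) t * {t | g t = x}.indicator 1 t =
          ({t | f t x = 0} ∩ {t | g t = x}).indicator 1 t := fun t => by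
        rw [inter_indicator_one]; rfl
      simp only [ψ, Option.elim_some, Sum.elim_inr, hz, hp, setIntegral_univ,
        integral_zero] at h
      rw [integral_indicator_one ((hZ x).inter (hgm x)), measureReal_eq_zero_iff] at h
      filter_upwards [measure_eq_zero_iff_ae_notMem.1 h] with t ht h'
      exact ht ⟨h'.2, h'.1⟩
    filter_upwards [ae_all_iff.2 hx] with t ht
    exact lt_of_le_of_ne (hf0 t _) fun h => ht (g t) ⟨rfl, h.symm⟩

end ConditionalLyapunov

section ProductIntegrals

lemma norm_prod_le_one {ι : Type*} {T : ι → Type*} {p : ∀ j, T j → ℝ} (hb : ∀ j a, |p j a| ≤ 1)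
    (S : Finset ι) (t : ∀ j, T j) : ‖∏ j ∈ S, p j (t j)‖ ≤ 1 := by
  rw [norm_prod]
  exact Finset.prod_le_one (fun j _ => norm_nonneg _) fun j _ => hb j _

lemma integrable_mul_prod {ι : Type*} [Fintype ι] {T : ι → Type*} [∀ i, MeasurableSpace (T i)]
    {μ : ∀ i, Measure (T i)} {w : (∀ j, T j) → ℝ} (hw : Integrable w (Measure.pi μ))
    {p : ∀ j, T j → ℝ} (hp : ∀ j, Measurable (p j)) (hb : ∀ j a, |p j a| ≤ 1) (S : Finset ι) :
    Integrable (fun t => w t * ∏ j ∈ S, p j (t j)) (Measure.pi μ) :=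
  hw.mul_bdd (c := 1)
    (Finset.measurable_prod _ fun j _ => (hp j).comp (measurable_pi_apply j)).aestronglyMeasurable
    (ae_of_all _ (norm_prod_le_one hb S))

lemma prod_update_eq {ι : Type*} [Fintype ι] [DecidableEq ι] {T : ι → Type*} (p : ∀ j, T j → ℝ)
    (k : ι) (s : ∀ j, T j) (a : T k) :
    ∏ j, p j (Function.update s k a j) = p k a * ∏ j ∈ Finset.univ.erase k, p j (s j) := by
  rw [← Finset.mul_prod_erase _ _ (Finset.mem_univ k), Function.update_self]
  congr 1
  exact Finset.prod_congr rfl fun j hj => by rw [Function.update_of_ne (Finset.ne_of_mem_erase hj)]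

variable {ι : Type*} [Fintype ι] [DecidableEq ι] {T : ι → Type*} [∀ i, MeasurableSpace (T i)]
  {μ : ∀ i, Measure (T i)} [∀ i, IsProbabilityMeasure (μ i)]

/-- Resampling one coordinate independently preserves a product of probability measures. -/
lemma measurePreserving_update_pi (k : ι) :
    MeasurePreserving (fun p : (∀ i, T i) × T k => Function.update p.1 k p.2)
      ((Measure.pi μ).prod (μ k)) (Measure.pi μ) := by
  have hm : Measurable (fun p : (∀ i, T i) × T k => Function.update p.1 k p.2) := by
    fun_prop
  refine ⟨hm, (Measure.pi_eq fun A hA => ?_).symm⟩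
  have hpre : (fun p : (∀ i, T i) × T k => Function.update p.1 k p.2) ⁻¹' (univ.pi A) =
      (univ.pi (Function.update A k univ)) ×ˢ A k := by
    ext ⟨s, a⟩
    simp only [mem_preimage, mem_univ_pi, mem_prod]
    constructor
    · intro h
      refine ⟨fun j => ?_, by simpa using h k⟩
      by_cases hj : j = k
      · subst hj; simp
      · simpa [hj] using h j
    · rintro ⟨h1, h2⟩ j
      by_cases hj : j = k
      · subst hj; simpa using h2
      · simpa [hj] using h1 j
  rw [Measure.map_apply hm (MeasurableSet.univ_pi hA), hpre, Measure.prod_prod, Measure.pi_pi,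
    ← Finset.mul_prod_erase _ (fun i => μ i (A i)) (Finset.mem_univ k),
    ← Finset.mul_prod_erase _ _ (Finset.mem_univ k), mul_comm]
  congr 1
  simp only [Function.update_self, measure_univ, one_mul]
  exact Finset.prod_congr rfl fun j hj => by rw [Function.update_of_ne (Finset.ne_of_mem_erase hj)]

lemma integral_pi_eq_integral_update (k : ι) {F : (∀ j, T j) → ℝ}
    (hF : Integrable F (Measure.pi μ)) :
    ∫ t, F t ∂(Measure.pi μ) =
      ∫ z : (∀ j, T j) × T k, F (Function.update z.1 k z.2) ∂((Measure.pi μ).prod (μ k)) := by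
  have hmp := measurePreserving_update_pi (μ := μ) k
  conv_lhs => rw [← hmp.map_eq]
  exact integral_map hmp.measurable.aemeasurable (by rw [hmp.map_eq]; exact hF.aestronglyMeasurable)

lemma integral_mul_prod_eq_left {w : (∀ j, T j) → ℝ} (hw : Integrable w (Measure.pi μ))
    {p : ∀ j, T j → ℝ} (hp : ∀ j, Measurable (p j)) (hb : ∀ j a, |p j a| ≤ 1) (k : ι) :
    ∫ t, w t * ∏ j, p j (t j) ∂(Measure.pi μ) =
      ∫ s, (∏ j ∈ Finset.univ.erase k, p j (s j)) *
        ∫ a, w (Function.update s k a) * p k a ∂(μ k) ∂(Measure.pi μ) := by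
  have hF := integrable_mul_prod hw hp hb Finset.univ
  have hmp := measurePreserving_update_pi (μ := μ) k
  rw [integral_pi_eq_integral_update k hF]
  refine (integral_prod _ (hmp.integrable_comp_of_integrable hF)).trans ?_
  refine integral_congr_ae (ae_of_all _ fun s => ?_)
  simp only [Function.comp_apply, prod_update_eq]
  rw [← integral_const_mul]
  refine integral_congr_ae (ae_of_all _ fun a => ?_)
  ring

lemma integral_mul_prod_eq_right {w : (∀ j, T j) → ℝ} (hw : Integrable w (Measure.pi μ))
    {p : ∀ j, T j → ℝ} (hp : ∀ j, Measurable (p j)) (hb : ∀ j a, |p j a| ≤ 1) (k : ι) :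
    ∫ t, w t * ∏ j, p j (t j) ∂(Measure.pi μ) =
      ∫ a, (∫ s, w (Function.update s k a) * ∏ j ∈ Finset.univ.erase k, p j (s j) ∂(Measure.pi μ)) *
        p k a ∂(μ k) := by
  have hF := integrable_mul_prod hw hp hb Finset.univ
  have hmp := measurePreserving_update_pi (μ := μ) k
  rw [integral_pi_eq_integral_update k hF]
  refine (integral_prod_symm _ (hmp.integrable_comp_of_integrable hF)).trans ?_
  refine integral_congr_ae (ae_of_all _ fun a => ?_)
  simp only [Function.comp_apply, prod_update_eq]
  rw [← integral_mul_const]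
  refine integral_congr_ae (ae_of_all _ fun s => ?_)
  ring

/-- The integral of `w` against a product of weights is unchanged when all weights but the `i`-th
are replaced by weights with the same integrals against the integrable sections of `w`. -/
lemma integral_mul_prod_congr {w : (∀ j, T j) → ℝ} (hw : Integrable w (Measure.pi μ))
    {p p' : ∀ j, T j → ℝ} (hp : ∀ j, Measurable (p j)) (hb : ∀ j a, |p j a| ≤ 1)
    (hp' : ∀ j, Measurable (p' j)) (hb' : ∀ j a, |p' j a| ≤ 1) (i : ι) (hi : p i = p' i)
    (hsec : ∀ k ≠ i, ∀ s, Integrable (fun a => w (Function.update s k a)) (μ k) →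
      ∫ a, w (Function.update s k a) * p' k a ∂(μ k) =
        ∫ a, w (Function.update s k a) * p k a ∂(μ k)) :
    ∫ t, w t * ∏ j, p' j (t j) ∂(Measure.pi μ) = ∫ t, w t * ∏ j, p j (t j) ∂(Measure.pi μ) := by
  let H : Finset ι → ∀ j, T j → ℝ := fun S j => if j ∈ S then p' j else p j
  have hHm : ∀ S j, Measurable (H S j) := fun S j => by
    simp only [H]; split_ifs; exacts [hp' j, hp j]
  have hHb : ∀ S j a, |H S j a| ≤ 1 := fun S j a => by
    simp only [H]; split_ifs; exacts [hb' j a, hb j a]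
  have key : ∀ S : Finset ι, i ∉ S → ∫ t, w t * ∏ j, H S j (t j) ∂(Measure.pi μ) =
      ∫ t, w t * ∏ j, p j (t j) ∂(Measure.pi μ) := by
    intro S
    induction S using Finset.induction_on with
    | empty => intro _; simp [H]
    | insert k S hk ih =>
      intro hiS
      rw [Finset.mem_insert, not_or] at hiS
      rw [← ih hiS.2, integral_mul_prod_eq_left hw (hHm _) (hHb _) k,
        integral_mul_prod_eq_left hw (hHm _) (hHb _) k]
      have hae := ((measurePreserving_update_pi (μ := μ) k).integrable_comp_of_integrable
        hw).prod_right_ae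
      refine integral_congr_ae ?_
      filter_upwards [hae] with s hs
      have h1 : ∏ j ∈ Finset.univ.erase k, H (insert k S) j (s j) =
          ∏ j ∈ Finset.univ.erase k, H S j (s j) :=
        Finset.prod_congr rfl fun j hj => by simp [H, Finset.ne_of_mem_erase hj]
      have h2 : H (insert k S) k = p' k := by simp [H]
      have h3 : H S k = p k := by simp [H, hk]
      rw [h1, h2, h3, hsec k (Ne.symm hiS.1) s hs]
  rw [← key (Finset.univ.erase i) (Finset.notMem_erase i _)]
  have : H (Finset.univ.erase i) = p' := by
    funext j
    by_cases hj : j = i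
    · subst hj; simp [H, hi]
    · simp [H, hj]
  rw [this]

end ProductIntegrals

section Strategies

lemma IsBehavioralStrategy.abs_le_one {A B : Type*} [MeasurableSpace A] [Fintype B]
    {f : A → B → ℝ} (hf : IsBehavioralStrategy f) (a : A) (b : B) : |f a b| ≤ 1 := by
  rw [abs_of_nonneg (hf.2.1 a b)]
  exact (Finset.single_le_sum (fun c _ => hf.2.1 a c) (Finset.mem_univ b)).trans_eq (hf.2.2 a)

lemma IsPureStrategy.isBehavioralStrategy_pureToBeh {n : ℕ} {T X : Fin n → Type*}
    [∀ i, MeasurableSpace (T i)] [∀ i, Fintype (X i)] [∀ i, DecidableEq (X i)]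
    {g : ∀ i, T i → X i} {i : Fin n} (hg : IsPureStrategy (g i)) :
    IsBehavioralStrategy (pureToBeh g i) := by
  refine ⟨fun b => Measurable.ite (hg b) measurable_const measurable_const, fun a b => ?_,
    fun a => by simp [pureToBeh]⟩
  simp only [pureToBeh]
  split_ifs <;> norm_num

lemma measurable_interInfo {n : ℕ} {T X : Fin n → Type*}
    (u : Fin n → (∀ i, X i) → (∀ i, T i) → ℝ) (q : (∀ i, T i) → ℝ)
    {i j : Fin n} (hij : j ≠ i) (x : ∀ k, X k) (s : ∀ k, T k) :
    Measurable[interInfo u q i] fun a => dwPayoff u q j x (Function.update s i a) :=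
  Measurable.of_comap_le <| (le_iSup_of_le j <| le_iSup_of_le hij <| le_iSup_of_le x <|
    le_iSup_of_le s le_rfl)

variable {n : ℕ} {T X : Fin n → Type*} [mT : ∀ i, MeasurableSpace (T i)]

lemma interInfo_le {q : (∀ i, T i) → ℝ} (hqm : Measurable q)
    {u : Fin n → (∀ i, X i) → (∀ i, T i) → ℝ} (hum : ∀ i x, Measurable (u i x)) (i : Fin n) :
    interInfo u q i ≤ mT i := by
  refine iSup_le fun j => iSup_le fun _ => iSup_le fun x => iSup_le fun s => ?_
  exact (((hum j x).mul hqm).comp (measurable_update s)).comap_le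

lemma behPayoff_eq_sum [∀ i, Fintype (X i)] {μ : Measure (∀ i, T i)} {lam : Measure (∀ i, T i)}
    {q : (∀ i, T i) → ℝ} (hqm : Measurable q) (hq0 : ∀ t, 0 ≤ q t)
    (hac : lam = μ.withDensity fun t => ENNReal.ofReal (q t))
    {u : Fin n → (∀ i, X i) → (∀ i, T i) → ℝ} {i : Fin n}
    (hw : ∀ x, Integrable (dwPayoff u q i x) μ)
    {f : ∀ i, T i → X i → ℝ} (hf : ∀ i, IsBehavioralStrategy (f i)) :
    behPayoff lam u f i =
      ∑ x, ∫ t, dwPayoff u q i x t * ∏ j, f j (t j) (x j) ∂μ := by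
  rw [behPayoff, hac, integral_withDensity_eq_integral_toReal_smul hqm.ennreal_ofReal
    (ae_of_all _ fun _ => ENNReal.ofReal_lt_top), ← integral_finsetSum]
  · refine integral_congr_ae (ae_of_all _ fun t => ?_)
    simp only [ENNReal.toReal_ofReal (hq0 t), smul_eq_mul, Finset.mul_sum, dwPayoff]
    exact Finset.sum_congr rfl fun x _ => by ring
  · intro x _
    refine (hw x).mul_bdd (c := 1) (Finset.measurable_prod _ fun j _ =>
      ((hf j).1 (x j)).comp (measurable_pi_apply j)).aestronglyMeasurable (ae_of_all _ fun t => ?_)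
    exact norm_prod_le_one (p := fun j a => f j a (x j)) (fun j a => (hf j).abs_le_one a _) _ t

end Strategies

/-- strong purification: in a Bayesian game with finite actions with
coarser inter-player information, every behavioral strategy profile `f` possesses a strong
purification: a pure strategy profile `g` which is strongly payoff equivalent to `f`,
distribution equivalent to `f`, and belief consistent with `f`. -/
theorem bayesian_game_coarser_interInfo_strong_purification
    (n : ℕ) (hn : 1 ≤ n) (T X : Fin n → Type)
    [mT : ∀ i, MeasurableSpace (T i)]
    (hcg : ∀ i, MeasurableSpace.CountablyGenerated (T i))
    [∀ i, Fintype (X i)] [∀ i, DecidableEq (X i)] [∀ i, Nonempty (X i)]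
    (lamM : ∀ i, Measure (T i)) [∀ i, IsProbabilityMeasure (lamM i)]
    (hatomless : ∀ i, AtomlessMeasure (lamM i))
    (lam : Measure (∀ i, T i)) [IsProbabilityMeasure lam]
    (hmarg : ∀ i, lam.map (fun t => t i) = lamM i)
    (q : (∀ i, T i) → ℝ) (hqm : Measurable q) (hq0 : ∀ t, 0 ≤ q t)
    (hac : lam = (Measure.pi lamM).withDensity fun t => ENNReal.ofReal (q t))
    (u : Fin n → (∀ i, X i) → (∀ i, T i) → ℝ)
    (hum : ∀ i x, Measurable (u i x))
    (hubd : ∃ h : (∀ i, T i) → ℝ, Integrable h lam ∧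
      ∀ i x, ∀ᵐ t ∂lam, |u i x t| ≤ h t)
    (hcoarser : ∀ i, HasNoCondAtom (mT i) (interInfo u q i) (lamM i))
    (f : ∀ i, T i → X i → ℝ) (hf : ∀ i, IsBehavioralStrategy (f i)) :
    ∃ g : ∀ i, T i → X i,
      (∀ i, IsPureStrategy (g i)) ∧
      -- payoff equivalence
      (∀ i, behPayoff lam u (pureToBeh g) i = behPayoff lam u f i) ∧
      -- strong payoff equivalence: unilateral deviations
      (∀ (i : Fin n) (h : T i → X i → ℝ), IsBehavioralStrategy h →
        behPayoff lam u (Function.update (pureToBeh g) i h) i =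
          behPayoff lam u (Function.update f i h) i) ∧
      -- distribution equivalence
      (∀ (i : Fin n) (x : X i),
        (lamM i {ti | g i ti = x}).toReal = ∫ ti, f i ti x ∂(lamM i)) ∧
      -- belief consistency
      (∀ i, ∀ᵐ ti ∂(lamM i), 0 < f i ti (g i ti)) := by
  obtain ⟨b, hb, hub⟩ := hubd
  have hG : ∀ i, interInfo u q i ≤ mT i := interInfo_le hqm hum
  have hdm : ∀ i x, Measurable (dwPayoff u q i x) := fun i x => (hum i x).mul hqm
  have hw : ∀ i x, Integrable (dwPayoff u q i x) (Measure.pi lamM) := fun i x => by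
    have hu : Integrable (u i x) lam := hb.mono' (hum i x).aestronglyMeasurable (hub i x)
    rw [hac, integrable_withDensity_iff_integrable_smul' hqm.ennreal_ofReal
      (ae_of_all _ fun _ => ENNReal.ofReal_lt_top)] at hu
    refine hu.congr (ae_of_all _ fun t => ?_)
    simp only [ENNReal.toReal_ofReal (hq0 t), smul_eq_mul, dwPayoff, mul_comm]
  let V : ∀ i, (∀ j, X j) → T i → ℝ := fun i x a =>
    ∫ s, dwPayoff u q i x (Function.update s i a) *
      ∏ j ∈ Finset.univ.erase i, f j (s j) (x j) ∂(Measure.pi lamM)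
  have hfm : ∀ (x : ∀ j, X j) j, Measurable fun a => f j a (x j) := fun x j => (hf j).1 (x j)
  have hfb : ∀ (x : ∀ j, X j) j a, |f j a (x j)| ≤ 1 := fun x j a => (hf j).abs_le_one a (x j)
  have hVm : ∀ i x, Measurable (V i x) := fun i x => by
    have h1 : Measurable fun p : (∀ j, T j) × T i => dwPayoff u q i x (Function.update p.1 i p.2) *
        ∏ j ∈ Finset.univ.erase i, f j (p.1 j) (x j) :=
      ((hdm i x).comp (measurePreserving_update_pi (μ := lamM) i).measurable).mul
        (Finset.measurable_prod _ fun j _ =>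
          (hfm x j).comp ((measurable_pi_apply j).comp measurable_fst))
    exact h1.stronglyMeasurable.integral_prod_left'.measurable
  have hVi : ∀ i x, Integrable (V i x) (lamM i) := fun i x => by
    have h1 := ((measurePreserving_update_pi (μ := lamM) i).integrable_comp_of_integrable
      (hw i x)).mul_bdd (c := 1) (g := fun p => ∏ j ∈ Finset.univ.erase i, f j (p.1 j) (x j))
      (Finset.measurable_prod _ fun j _ =>
        (hfm x j).comp ((measurable_pi_apply j).comp measurable_fst)).aestronglyMeasurable
      (ae_of_all _ fun p => norm_prod_le_one (hfb x) _ p.1)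
    exact h1.integral_prod_right
  choose g hgp hgw hgV hgs using fun i =>
    (hcoarser i).exists_isPureStrategy (hG i) (hVm i) (hVi i) (hf i)
  have hgb : ∀ i, IsBehavioralStrategy (pureToBeh g i) := fun i =>
    (hgp i).isBehavioralStrategy_pureToBeh
  have hupd : ∀ {f' : ∀ i, T i → X i → ℝ}, (∀ i, IsBehavioralStrategy (f' i)) →
      ∀ (i : Fin n) (h : T i → X i → ℝ), IsBehavioralStrategy h →
        ∀ j, IsBehavioralStrategy (Function.update f' i h j) := by
    intro f' hf' i h hh j
    by_cases hj : j = i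
    · subst hj; simpa using hh
    · simpa [hj] using hf' j
  have hdev : ∀ (i : Fin n) (h : T i → X i → ℝ), IsBehavioralStrategy h →
      behPayoff lam u (Function.update (pureToBeh g) i h) i =
        behPayoff lam u (Function.update f i h) i := by
    intro i h hh
    have hfu := hupd hf i h hh
    have hgu := hupd hgb i h hh
    rw [behPayoff_eq_sum hqm hq0 hac (hw i) hfu, behPayoff_eq_sum hqm hq0 hac (hw i) hgu]
    refine Finset.sum_congr rfl fun x _ => ?_
    refine integral_mul_prod_congr (hw i x) (p := fun j a => Function.update f i h j a (x j))
      (p' := fun j a => Function.update (pureToBeh g) i h j a (x j))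
      (fun j => (hfu j).1 _) (fun j a => (hfu j).abs_le_one a _)
      (fun j => (hgu j).1 _) (fun j a => (hgu j).abs_le_one a _) i (by simp) fun k hk s hs => ?_
    simp only [Function.update_of_ne hk]
    exact hgw k (x k) _ (measurable_interInfo u q hk.symm x s) hs
  refine ⟨g, hgp, fun i => ?_, hdev, fun i x => ?_, hgs⟩
  · have h1 := hdev i (pureToBeh g i) (hgb i)
    rw [Function.update_eq_self] at h1
    have hfu := hupd hf i _ (hgb i)
    rw [h1, behPayoff_eq_sum hqm hq0 hac (hw i) hfu, behPayoff_eq_sum hqm hq0 hac (hw i) hf]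
    refine Finset.sum_congr rfl fun x _ => ?_
    rw [integral_mul_prod_eq_right (hw i x) (hfm x) (hfb x) i,
      integral_mul_prod_eq_right (hw i x)
        (p := fun j a => Function.update f i (pureToBeh g i) j a (x j))
        (fun j => (hfu j).1 _) (fun j a => (hfu j).abs_le_one a _) i]
    refine Eq.trans ?_ (hgV i (x i) x)
    refine integral_congr_ae (ae_of_all _ fun a => ?_)
    simp only [Function.update_self, V]
    refine congrArg₂ _ (integral_congr_ae (ae_of_all _ fun s => ?_)) rfl
    refine congrArg₂ _ rfl (Finset.prod_congr rfl fun j hj => ?_)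
    rw [Function.update_of_ne (Finset.ne_of_mem_erase hj)]
  · have h1 := hgw i x (fun _ => 1) measurable_const (integrable_const 1)
    simp only [one_mul] at h1
    rw [← h1, ← measureReal_def, ← integral_indicator_one (hgp i x)]
    simp [indicator_apply]
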